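/- The map T'(m,n,p) : I'(m,n,p) → J'(m,n,p) defined by (t,s) ↦ (max{m+p, n+s} - t, s) is a well-defined bijection with inverse T'(p+1,n,m-1), where I'(m,n,p) = {(t,s) : |m-n|+k+1 ≤ t ≤ m+n-k-1, |t-p-1|+k ≤ s ≤ t+p-k-1} and J'(m,n,p) = {(v,u) : |n-p-1|+k ≤ v ≤ n+p-k-1, |m-v-1|+k ≤ u ≤ m+v-k-1}. -/

import Mathlib

/-- The index set `I'(m,n,p)` of Proposition 6.1(3). -/
def Iset' (k m n p : ℤ) : Set (ℤ × ℤ) :=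
  {ts | |m - n| + k + 1 ≤ ts.1 ∧ ts.1 ≤ m + n - k - 1 ∧
    |ts.1 - p - 1| + k ≤ ts.2 ∧ ts.2 ≤ ts.1 + p - k - 1}

/-- The index set `J'(m,n,p)` of Proposition 6.1(3). -/
def Jset' (k m n p : ℤ) : Set (ℤ × ℤ) :=
  {vu | |n - p - 1| + k ≤ vu.1 ∧ vu.1 ≤ n + p - k - 1 ∧
    |m - vu.1 - 1| + k ≤ vu.2 ∧ vu.2 ≤ m + vu.1 - k - 1}

/-- The map `T'(m,n,p)(t,s) = (max{m+p, n+s} - t, s)`. -/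
def Tmap' (m n p : ℤ) (ts : ℤ × ℤ) : ℤ × ℤ := (max (m + p) (n + ts.2) - ts.1, ts.2)

/-- `T'(m,n,p) : I'(m,n,p) → J'(m,n,p)` is a well-defined bijection with
inverse `T'(p+1,n,m-1)`. -/
theorem stmt3 (k m n p : ℤ) (hk : 0 ≤ k) (hm : k + 1 ≤ m) (hn : k + 1 ≤ n) (hp : k ≤ p) :
    (∀ ts ∈ Iset' k m n p, Tmap' m n p ts ∈ Jset' k m n p) ∧
    (∀ ts ∈ Iset' k m n p, Tmap' (p + 1) n (m - 1) (Tmap' m n p ts) = ts) ∧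
    (∀ vu ∈ Jset' k m n p, Tmap' (p + 1) n (m - 1) vu ∈ Iset' k m n p) ∧
    (∀ vu ∈ Jset' k m n p, Tmap' m n p (Tmap' (p + 1) n (m - 1) vu) = vu) := by
  simp only [Iset', Jset', Tmap', Set.mem_ofPred_eq, Prod.forall, Prod.mk.injEq,
    ← le_sub_iff_add_le, abs_le]
  refine ⟨?_, ?_, ?_, ?_⟩ <;> intros <;> grind
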